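/- Fix A ∈ ℝ^d, r > 0, b̄ ≠ 0. For a unit vector v ∈ S^{d-1}, let σ(v) = (b̄^2 - 1)/(2b̄) + (b̄/2)|A + r v|^2 be the spherical curvature of the stereographic lift of the sphere of curvature b̄ centered at A + r v. If {v_1,…,v_n} and {w_1,…,w_q} are two spherical M-designs in S^{d-1}, then for every m ≤ M, (1/n) ∑_i σ(v_i)^m = (1/q) ∑_j σ(w_j)^m. -/

import Mathlib

open MeasureTheory

/-- A spherical `M`-design on the unit sphere of `ℝ^D`. -/
def IsSphericalDesign (D M n : ℕ) (x : Fin n → EuclideanSpace ℝ (Fin D)) : Prop :=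
  (∀ i, ‖x i‖ = 1) ∧
    ∀ F : MvPolynomial (Fin D) ℝ, F.totalDegree ≤ M →
      (1 / (n : ℝ)) * ∑ i, MvPolynomial.eval (x i) F
        = ⨍ v : Metric.sphere (0 : EuclideanSpace ℝ (Fin D)) 1,
            MvPolynomial.eval (v : EuclideanSpace ℝ (Fin D)) F ∂(volume.toSphere)

/-- The affine polynomial `c + ∑ i, a i * X i`. -/
noncomputable def affinePoly {ι : Type*} [Fintype ι] (c : ℝ) (a : ι → ℝ) : MvPolynomial ι ℝ :=
  MvPolynomial.C c + ∑ i, MvPolynomial.C (a i) * MvPolynomial.X i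

lemma totalDegree_affinePoly_pow_le {ι : Type*} [Fintype ι] (c : ℝ) (a : ι → ℝ) (m : ℕ) :
    (affinePoly c a ^ m).totalDegree ≤ m := by
  have h : (affinePoly c a).totalDegree ≤ 1 := by
    refine (MvPolynomial.totalDegree_add _ _).trans (max_le (by simp) ?_)
    refine MvPolynomial.totalDegree_finsetSum_le fun i _ => ?_
    exact (MvPolynomial.totalDegree_mul _ _).trans (by simp)
  exact (MvPolynomial.totalDegree_pow _ _).trans (by simpa using Nat.mul_le_mul_left m h)

lemma eval_affinePoly {ι : Type*} [Fintype ι] (c : ℝ) (a x : ι → ℝ) :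
    MvPolynomial.eval x (affinePoly c a) = c + ∑ i, a i * x i := by
  simp [affinePoly]

lemma norm_add_smul_sq_of_norm_eq_one {ι : Type*} [Fintype ι] (A u : EuclideanSpace ℝ ι)
    (r : ℝ) (hu : ‖u‖ = 1) :
    ‖A + r • u‖ ^ 2 = ‖A‖ ^ 2 + r ^ 2 + 2 * r * ∑ i, A i * u i := by
  have hinner : inner ℝ A u = ∑ i, A i * u i := by
    simp [PiLp.inner_apply, mul_comm]
  rw [norm_add_sq_real, inner_smul_right, hinner, norm_smul, hu, mul_one, Real.norm_eq_abs,
    sq_abs]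
  ring

/-- **Theorem 3.1.** Let `σ(v) = (bb² - 1)/(2 bb) + (bb/2)|A + r v|²` be the spherical
curvature of the stereographic lift of the sphere of curvature `bb` centered at `A + r v`.
Then the `m`-th power-sum averages of `σ` over any two spherical `M`-designs agree, for
every `m ≤ M`. -/
theorem spherical_curvature_moments_design_independent {d M : ℕ}
    (A : EuclideanSpace ℝ (Fin d)) (r bb : ℝ) (hr : 0 < r) (hbb : bb ≠ 0)
    (σ : EuclideanSpace ℝ (Fin d) → ℝ)
    (hσ : ∀ v, σ v = (bb ^ 2 - 1) / (2 * bb) + (bb / 2) * ‖A + r • v‖ ^ 2)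
    {n q : ℕ} (v : Fin n → EuclideanSpace ℝ (Fin d)) (w : Fin q → EuclideanSpace ℝ (Fin d))
    (hv : IsSphericalDesign d M n v) (hw : IsSphericalDesign d M q w)
    (m : ℕ) (hm : m ≤ M) :
    (1 / (n : ℝ)) * ∑ i, (σ (v i)) ^ m = (1 / (q : ℝ)) * ∑ j, (σ (w j)) ^ m := by
  set c : ℝ := (bb ^ 2 - 1) / (2 * bb) + (bb / 2) * (‖A‖ ^ 2 + r ^ 2)
  set F := affinePoly c (fun i => bb * r * A i)
  have hF : ∀ u : EuclideanSpace ℝ (Fin d), ‖u‖ = 1 →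
      σ u ^ m = MvPolynomial.eval u (F ^ m) := by
    intro u hu
    rw [map_pow, eval_affinePoly, hσ, norm_add_smul_sq_of_norm_eq_one A u r hu]
    simp only [mul_assoc, ← Finset.mul_sum, c]
    ring
  have hdeg : (F ^ m).totalDegree ≤ M := (totalDegree_affinePoly_pow_le _ _ m).trans hm
  simp only [fun i => hF (v i) (hv.1 i), fun j => hF (w j) (hw.1 j)]
  exact (hv.2 _ hdeg).trans (hw.2 _ hdeg).symm
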